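/- There exist constants C₁, C₂, C₃ > 0, depending only on L, D and k₂, with the following property: for every T > 0 and every classical solution w of the full damped inextensible cantilever system with p ≡ 0 on [0,L]×[0,T], the quantity X₀(t) = ‖w_t(t)‖² + ‖w_xx(t)‖² + ‖(w_x w_xx)(t)‖² + ‖u_t(t)‖² satisfies X₀(T) + C₁ ∫₀ᵀ X₀(s) ds ≤ C₂ X₀(0) + C₃ ∫₀ᵀ X₀(s)⁶ ds. -/

import Mathlib

open MeasureTheory Set

/-- Spatial partial derivative of a function of `(x, t)`. -/
noncomputable def pdx (f : ℝ → ℝ → ℝ) : ℝ → ℝ → ℝ := fun x t => deriv (fun y => f y t) x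

/-- Temporal partial derivative of a function of `(x, t)`. -/
noncomputable def pdt (f : ℝ → ℝ → ℝ) : ℝ → ℝ → ℝ := fun x t => deriv (fun s => f x s) t

/-- Axial displacement from the effective inextensibility constraint:
`u(x,t) = -(1/2)∫₀ˣ w_x(ξ,t)² dξ`. -/
noncomputable def uF (w : ℝ → ℝ → ℝ) : ℝ → ℝ → ℝ := fun x t =>
  -(1/2) * ∫ ξ in (0:ℝ)..x, (pdx w ξ t) ^ 2

/-- `u_t(x,t) = -∫₀ˣ w_x w_xt dξ`. -/
noncomputable def utF (w : ℝ → ℝ → ℝ) : ℝ → ℝ → ℝ := fun x t =>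
  -∫ ξ in (0:ℝ)..x, pdx w ξ t * pdt (pdx w) ξ t

/-- `u_tt(x,t) = -∫₀ˣ [w_xt² + w_x w_xtt] dξ`. -/
noncomputable def uttF (w : ℝ → ℝ → ℝ) : ℝ → ℝ → ℝ := fun x t =>
  -∫ ξ in (0:ℝ)..x, ((pdt (pdx w) ξ t) ^ 2 + pdx w ξ t * pdt (pdt (pdx w)) ξ t)

/-- A classical solution of the full damped inextensible cantilever system on
`[0,L] × [0,T]` with forcing `p`: smooth on an open neighborhood of `[0,L] × [0,T]`,
satisfying the PDE
`w_tt + D ∂ₓ⁴w + k₂ ∂ₓ⁴w_t − D ∂ₓ(w_xx² w_x) + D ∂ₓ²(w_x² w_xx) + ∂ₓ(w_x ∫ₓᴸ u_tt dξ) = p`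
pointwise and the clamped-free boundary conditions. -/
def IsFullSol (L D k2 T : ℝ) (p w : ℝ → ℝ → ℝ) : Prop :=
  (∃ U : Set (ℝ × ℝ), IsOpen U ∧ Icc (0:ℝ) L ×ˢ Icc (0:ℝ) T ⊆ U ∧
      ContDiffOn ℝ (⊤ : ℕ∞) (fun q : ℝ × ℝ => w q.1 q.2) U) ∧
  (∀ x ∈ Icc (0:ℝ) L, ∀ t ∈ Icc (0:ℝ) T,
      pdt (pdt w) x t + D * pdx (pdx (pdx (pdx w))) x t
        + k2 * pdx (pdx (pdx (pdx (pdt w)))) x t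
        - D * pdx (fun y s => (pdx (pdx w) y s) ^ 2 * pdx w y s) x t
        + D * pdx (pdx (fun y s => (pdx w y s) ^ 2 * pdx (pdx w) y s)) x t
        + pdx (fun y s => pdx w y s * ∫ ξ in y..L, uttF w ξ s) x t
      = p x t) ∧
  (∀ t ∈ Icc (0:ℝ) T,
    w 0 t = 0 ∧ pdx w 0 t = 0 ∧ pdx (pdx w) L t = 0 ∧ pdx (pdx (pdx w)) L t = 0)

/-- `u_xxt = -(w_xx w_xt + w_x w_xxt)` (closed pointwise form). -/
noncomputable def uxxtF (w : ℝ → ℝ → ℝ) : ℝ → ℝ → ℝ := fun x t =>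
  -(pdx (pdx w) x t * pdt (pdx w) x t + pdx w x t * pdt (pdx (pdx w)) x t)

/-- `u_ttt(x,t) = -∫₀ˣ [3 w_xt w_xtt + w_x w_xttt] dξ`. -/
noncomputable def utttF (w : ℝ → ℝ → ℝ) : ℝ → ℝ → ℝ := fun x t =>
  -∫ ξ in (0:ℝ)..x,
    (3 * pdt (pdx w) ξ t * pdt (pdt (pdx w)) ξ t
      + pdx w ξ t * pdt (pdt (pdt (pdx w))) ξ t)

/-- Level-zero energy `X₀(t) = ‖w_t‖² + ‖w_xx‖² + ‖w_x w_xx‖² + ‖u_t‖²`. -/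
noncomputable def X0 (L : ℝ) (w : ℝ → ℝ → ℝ) (t : ℝ) : ℝ :=
  (∫ x in (0:ℝ)..L, (pdt w x t) ^ 2)
    + (∫ x in (0:ℝ)..L, (pdx (pdx w) x t) ^ 2)
    + (∫ x in (0:ℝ)..L, (pdx w x t * pdx (pdx w) x t) ^ 2)
    + (∫ x in (0:ℝ)..L, (utF w x t) ^ 2)

/-- Level-one energy `X₁(t) = ‖w_tt‖² + ‖w_xxt‖² + ‖w_xt w_xx‖² + ‖w_x w_xxt‖² + ‖u_tt‖²`. -/
noncomputable def X1 (L : ℝ) (w : ℝ → ℝ → ℝ) (t : ℝ) : ℝ :=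
  (∫ x in (0:ℝ)..L, (pdt (pdt w) x t) ^ 2)
    + (∫ x in (0:ℝ)..L, (pdt (pdx (pdx w)) x t) ^ 2)
    + (∫ x in (0:ℝ)..L, (pdt (pdx w) x t * pdx (pdx w) x t) ^ 2)
    + (∫ x in (0:ℝ)..L, (pdx w x t * pdt (pdx (pdx w)) x t) ^ 2)
    + (∫ x in (0:ℝ)..L, (uttF w x t) ^ 2)

/-- Level-two energy `X₂(t) = ‖w_xxt‖² + ‖∂ₓ⁴w‖² + ‖w_x ∂ₓ⁴w‖² + ‖u_xxt‖²`. -/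
noncomputable def X2 (L : ℝ) (w : ℝ → ℝ → ℝ) (t : ℝ) : ℝ :=
  (∫ x in (0:ℝ)..L, (pdt (pdx (pdx w)) x t) ^ 2)
    + (∫ x in (0:ℝ)..L, (pdx (pdx (pdx (pdx w))) x t) ^ 2)
    + (∫ x in (0:ℝ)..L, (pdx w x t * pdx (pdx (pdx (pdx w))) x t) ^ 2)
    + (∫ x in (0:ℝ)..L, (uxxtF w x t) ^ 2)

/-- Level-three energy
`X₃(t) = ‖w_ttt‖² + ‖w_xxtt‖² + ‖w_x w_xxtt‖² + ‖w_xx w_xtt‖² + ‖u_ttt‖²`. -/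
noncomputable def X3 (L : ℝ) (w : ℝ → ℝ → ℝ) (t : ℝ) : ℝ :=
  (∫ x in (0:ℝ)..L, (pdt (pdt (pdt w)) x t) ^ 2)
    + (∫ x in (0:ℝ)..L, (pdt (pdt (pdx (pdx w))) x t) ^ 2)
    + (∫ x in (0:ℝ)..L, (pdx w x t * pdt (pdt (pdx (pdx w))) x t) ^ 2)
    + (∫ x in (0:ℝ)..L, (pdx (pdx w) x t * pdt (pdt (pdx w)) x t) ^ 2)
    + (∫ x in (0:ℝ)..L, (utttF w x t) ^ 2)

/-- Global joint smoothness of a function of two real variables. -/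
def Sm (f : ℝ → ℝ → ℝ) : Prop := ContDiff ℝ (⊤ : ℕ∞) (fun q : ℝ × ℝ => f q.1 q.2)

lemma Sm.diff {f : ℝ → ℝ → ℝ} (hf : Sm f) (q : ℝ × ℝ) :
    HasFDerivAt (fun q : ℝ × ℝ => f q.1 q.2) (fderiv ℝ (fun q : ℝ × ℝ => f q.1 q.2) q) q := by
  have h : Differentiable ℝ (fun q : ℝ × ℝ => f q.1 q.2) := ContDiff.differentiable hf (by simp)
  exact (h q).hasFDerivAt

lemma Sm.hx' {f : ℝ → ℝ → ℝ} (hf : Sm f) (x t : ℝ) :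
    HasDerivAt (fun y => f y t) (fderiv ℝ (fun q : ℝ × ℝ => f q.1 q.2) (x, t) (1, 0)) x := by
  have h1 : HasDerivAt (fun y : ℝ => ((y, t) : ℝ × ℝ)) (1, 0) x :=
    (hasDerivAt_id x).prodMk (hasDerivAt_const x t)
  exact (hf.diff (x, t)).comp_hasDerivAt x h1

lemma Sm.ht' {f : ℝ → ℝ → ℝ} (hf : Sm f) (x t : ℝ) :
    HasDerivAt (fun s => f x s) (fderiv ℝ (fun q : ℝ × ℝ => f q.1 q.2) (x, t) (0, 1)) t := by
  have h1 : HasDerivAt (fun y : ℝ => ((x, y) : ℝ × ℝ)) (0, 1) t :=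
    (hasDerivAt_const t x).prodMk (hasDerivAt_id t)
  exact (hf.diff (x, t)).comp_hasDerivAt t h1

lemma Sm.pdx_eq {f : ℝ → ℝ → ℝ} (hf : Sm f) :
    pdx f = fun x t => fderiv ℝ (fun q : ℝ × ℝ => f q.1 q.2) (x, t) (1, 0) := by
  funext x t; exact (hf.hx' x t).deriv

lemma Sm.pdt_eq {f : ℝ → ℝ → ℝ} (hf : Sm f) :
    pdt f = fun x t => fderiv ℝ (fun q : ℝ × ℝ => f q.1 q.2) (x, t) (0, 1) := by
  funext x t; exact (hf.ht' x t).deriv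

lemma Sm.hx {f : ℝ → ℝ → ℝ} (hf : Sm f) (x t : ℝ) :
    HasDerivAt (fun y => f y t) (pdx f x t) x := by
  rw [hf.pdx_eq]; exact hf.hx' x t

lemma Sm.ht {f : ℝ → ℝ → ℝ} (hf : Sm f) (x t : ℝ) :
    HasDerivAt (fun s => f x s) (pdt f x t) t := by
  rw [hf.pdt_eq]; exact hf.ht' x t

lemma Sm.fd {f : ℝ → ℝ → ℝ} (hf : Sm f) :
    ContDiff ℝ (⊤ : ℕ∞) (fderiv ℝ (fun q : ℝ × ℝ => f q.1 q.2)) :=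
  ContDiff.fderiv_right hf (by simp)

lemma Sm.x {f : ℝ → ℝ → ℝ} (hf : Sm f) : Sm (pdx f) := by
  rw [hf.pdx_eq]
  exact hf.fd.clm_apply contDiff_const

lemma Sm.t {f : ℝ → ℝ → ℝ} (hf : Sm f) : Sm (pdt f) := by
  rw [hf.pdt_eq]
  exact hf.fd.clm_apply contDiff_const

lemma Sm.comm {f : ℝ → ℝ → ℝ} (hf : Sm f) : pdt (pdx f) = pdx (pdt f) := by
  rw [hf.x.pdt_eq, hf.t.pdx_eq]
  funext x t
  rw [hf.pdx_eq, hf.pdt_eq]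
  have h0 : DifferentiableAt ℝ (fderiv ℝ (fun q : ℝ × ℝ => f q.1 q.2)) (x, t) :=
    (hf.fd.differentiable (by simp)) _
  have e : ∀ v : ℝ × ℝ, fderiv ℝ (fun q : ℝ × ℝ =>
      fderiv ℝ (fun q : ℝ × ℝ => f q.1 q.2) (q.1, q.2) v) (x, t)
      = (fderiv ℝ (fderiv ℝ (fun q : ℝ × ℝ => f q.1 q.2)) (x, t)).flip v := by
    intro v
    have := (h0.hasFDerivAt.clm_apply (hasFDerivAt_const v (x, t))).fderiv
    simpa using this
  rw [e, e]
  have hs : IsSymmSndFDerivAt ℝ (fun q : ℝ × ℝ => f q.1 q.2) (x, t) :=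
    ContDiffAt.isSymmSndFDerivAt (n := (⊤ : ℕ∞)) (ContDiff.contDiffAt hf)
      (by
        rw [minSmoothness_of_isRCLikeNormedField]
        exact WithTop.coe_le_coe.2 (le_top : (2 : ℕ∞) ≤ ⊤))
  exact hs _ _

lemma Sm.cont {f : ℝ → ℝ → ℝ} (hf : Sm f) : Continuous (fun q : ℝ × ℝ => f q.1 q.2) :=
  ContDiff.continuous hf

lemma Sm.contx {f : ℝ → ℝ → ℝ} (hf : Sm f) (t : ℝ) : Continuous (fun x => f x t) :=
  hf.cont.comp (by fun_prop : Continuous fun x : ℝ => (x, t))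

lemma Sm.mul {f g : ℝ → ℝ → ℝ} (hf : Sm f) (hg : Sm g) : Sm (fun x t => f x t * g x t) :=
  ContDiff.mul hf hg

lemma Sm.pow {f : ℝ → ℝ → ℝ} (hf : Sm f) (n : ℕ) : Sm (fun x t => f x t ^ n) :=
  ContDiff.pow hf n

/-- Differentiation under the integral sign. -/
lemma leibniz {F F' : ℝ → ℝ → ℝ} (a b t : ℝ)
    (hF : Continuous (fun q : ℝ × ℝ => F q.1 q.2))
    (hF' : Continuous (fun q : ℝ × ℝ => F' q.1 q.2))
    (hd : ∀ x t, HasDerivAt (fun s => F x s) (F' x t) t) :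
    HasDerivAt (fun s => ∫ x in a..b, F x s) (∫ x in a..b, F' x t) t := by
  have hc : ∀ {G : ℝ → ℝ → ℝ} (s : ℝ), Continuous (fun q : ℝ × ℝ => G q.1 q.2) →
      Continuous (fun x => G x s) := fun s h =>
    h.comp (by fun_prop : Continuous fun x : ℝ => (x, s))
  obtain ⟨C, hC⟩ := (isCompact_uIcc (a := a) (b := b)).prod
    (isCompact_Icc (a := t - 1) (b := t + 1)) |>.exists_bound_of_continuousOn hF'.continuousOn
  refine (intervalIntegral.hasDerivAt_integral_of_dominated_loc_of_deriv_le
    (F := fun s x => F x s) (F' := fun s x => F' x s) (bound := fun _ => C)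
    (s := Icc (t - 1) (t + 1)) (Icc_mem_nhds (by linarith) (by linarith)) ?_ ?_ ?_ ?_ ?_ ?_).2
  · exact Filter.Eventually.of_forall fun s => (hc s hF).aestronglyMeasurable
  · exact (hc t hF).intervalIntegrable _ _
  · exact (hc t hF').aestronglyMeasurable
  · refine Filter.Eventually.of_forall fun x hx s hs => ?_
    exact hC (x, s) ⟨uIoc_subset_uIcc hx, hs⟩
  · exact intervalIntegrable_const
  · exact Filter.Eventually.of_forall fun x _ s _ => hd x s

lemma cont_prim {F : ℝ → ℝ → ℝ} (a : ℝ) (hF : Continuous (fun q : ℝ × ℝ => F q.1 q.2)) :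
    Continuous (fun q : ℝ × ℝ => ∫ ξ in a..q.1, F ξ q.2) := by
  apply intervalIntegral.continuous_parametric_intervalIntegral_of_continuous
    (f := fun (q : ℝ × ℝ) ξ => F ξ q.2)
  · exact hF.comp (by fun_prop : Continuous fun p : (ℝ × ℝ) × ℝ => (p.2, p.1.2))
  · fun_prop

lemma cont_int {F : ℝ → ℝ → ℝ} (a b : ℝ) (hF : Continuous (fun q : ℝ × ℝ => F q.1 q.2)) :
    Continuous (fun t => ∫ ξ in a..b, F ξ t) := by
  apply intervalIntegral.continuous_parametric_intervalIntegral_of_continuous'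
    (f := fun (t : ℝ) ξ => F ξ t)
  exact hF.comp (by fun_prop : Continuous fun p : ℝ × ℝ => (p.2, p.1))

lemma hasDerivAt_prim {f : ℝ → ℝ} (a x : ℝ) (hf : Continuous f) :
    HasDerivAt (fun y => ∫ ξ in a..y, f ξ) (f x) x :=
  intervalIntegral.integral_hasDerivAt_right (hf.intervalIntegrable _ _)
    (hf.stronglyMeasurableAtFilter _ _) hf.continuousAt

lemma hasDerivAt_prim' {f : ℝ → ℝ} (b x : ℝ) (hf : Continuous f) :
    HasDerivAt (fun y => ∫ ξ in y..b, f ξ) (-f x) x :=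
  intervalIntegral.integral_hasDerivAt_left (hf.intervalIntegrable _ _)
    (hf.stronglyMeasurableAtFilter _ _) hf.continuousAt

/-- Cauchy-Schwarz for continuous functions on an interval. -/
lemma cauchy {f g : ℝ → ℝ} {a b : ℝ} (hab : a ≤ b) (hf : Continuous f) (hg : Continuous g) :
    (∫ x in a..b, f x * g x) ^ 2 ≤ (∫ x in a..b, f x ^ 2) * ∫ x in a..b, g x ^ 2 := by
  have key : ∀ s : ℝ, 0 ≤ (∫ x in a..b, f x ^ 2) * (s * s)
      + (2 * ∫ x in a..b, f x * g x) * s + ∫ x in a..b, g x ^ 2 := by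
    intro s
    have h0 : 0 ≤ ∫ x in a..b, (s * f x + g x) ^ 2 :=
      intervalIntegral.integral_nonneg hab fun x _ => sq_nonneg _
    have h1 : ∫ x in a..b, (s * f x + g x) ^ 2
        = ∫ x in a..b, ((s * s) * f x ^ 2 + (2 * s) * (f x * g x)) + g x ^ 2 := by
      congr 1; funext x; ring
    rw [intervalIntegral.integral_add, intervalIntegral.integral_add,
      intervalIntegral.integral_const_mul, intervalIntegral.integral_const_mul] at h1
    · rw [h1] at h0; linarith
    all_goals exact Continuous.intervalIntegrable (by fun_prop) _ _
  have := discrim_le_zero key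
  unfold discrim at this
  nlinarith

lemma int_mono_top {f : ℝ → ℝ} {x L : ℝ} (_h0 : 0 ≤ x) (hx : x ≤ L) (hf : Continuous f)
    (hn : ∀ y, 0 ≤ f y) : ∫ y in (0:ℝ)..x, f y ≤ ∫ y in (0:ℝ)..L, f y := by
  rw [← intervalIntegral.integral_add_adjacent_intervals (hf.intervalIntegrable 0 x)
    (hf.intervalIntegrable x L)]
  have := intervalIntegral.integral_nonneg hx (μ := volume) fun y _ => hn y
  linarith

/-- Pointwise bound of a function vanishing at `0` by the `L²` norm of its derivative. -/
lemma sup_bound {g g' : ℝ → ℝ} {L x : ℝ} (hg : ∀ y, HasDerivAt g (g' y) y) (hc : Continuous g')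
    (h0 : g 0 = 0) (hx : x ∈ Icc 0 L) : g x ^ 2 ≤ L * ∫ y in (0:ℝ)..L, g' y ^ 2 := by
  have h1 : ∫ y in (0:ℝ)..x, g' y = g x := by
    rw [intervalIntegral.integral_eq_sub_of_hasDerivAt (fun y _ => hg y)
      (hc.intervalIntegrable _ _), h0, sub_zero]
  have h2 := cauchy hx.1 hc (continuous_const (y := (1:ℝ)))
  have h3 : ∫ y in (0:ℝ)..x, g' y ^ 2 ≤ ∫ y in (0:ℝ)..L, g' y ^ 2 :=
    int_mono_top hx.1 hx.2 (hc.pow 2) (fun y => sq_nonneg _)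
  have h4 : 0 ≤ ∫ y in (0:ℝ)..L, g' y ^ 2 :=
    intervalIntegral.integral_nonneg (hx.1.trans hx.2) fun y _ => sq_nonneg _
  simp only [mul_one, h1, one_pow, intervalIntegral.integral_const, smul_eq_mul, sub_zero] at h2
  have h5 := hx.1
  have h6 := hx.2
  calc g x ^ 2 ≤ (∫ y in (0:ℝ)..x, g' y ^ 2) * x := h2
    _ ≤ (∫ y in (0:ℝ)..L, g' y ^ 2) * L := by gcongr
    _ = _ := by ring

lemma int_le_const {f : ℝ → ℝ} {L C : ℝ} (hL : 0 ≤ L) (hf : Continuous f)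
    (h : ∀ x ∈ Icc 0 L, f x ≤ C) : ∫ x in (0:ℝ)..L, f x ≤ L * C := by
  have := intervalIntegral.integral_mono_on (μ := volume) hL (hf.intervalIntegrable 0 L)
    (intervalIntegrable_const (c := C)) h
  simpa using this

lemma poincare {g g' : ℝ → ℝ} {L : ℝ} (hL : 0 ≤ L) (hg : ∀ y, HasDerivAt g (g' y) y)
    (hc : Continuous g') (h0 : g 0 = 0) :
    ∫ y in (0:ℝ)..L, g y ^ 2 ≤ L ^ 2 * ∫ y in (0:ℝ)..L, g' y ^ 2 := by
  have hgc : Continuous g := continuous_iff_continuousAt.2 fun y => (hg y).continuousAt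
  have := int_le_const hL (hgc.pow 2) fun x hx => sup_bound hg hc h0 hx
  calc _ ≤ _ := this
    _ = _ := by ring

lemma deriv_zero_of_zero {g : ℝ → ℝ} {g' T t : ℝ} (hT : 0 < T) (ht : t ∈ Icc 0 T)
    (hz : ∀ s ∈ Icc 0 T, g s = 0) (hg : HasDerivAt g g' t) : g' = 0 := by
  have h1 : HasDerivWithinAt g g' (Icc 0 T) t := hg.hasDerivWithinAt
  have h2 : HasDerivWithinAt g 0 (Icc 0 T) t :=
    (hasDerivWithinAt_const t (Icc 0 T) (0:ℝ)).congr hz (hz t ht)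
  exact (uniqueDiffOn_Icc hT t ht).eq_deriv _ h1 h2

lemma uF_t {w : ℝ → ℝ → ℝ} (hw : Sm w) (x t : ℝ) :
    HasDerivAt (fun s => uF w x s) (utF w x t) t := by
  have h := (leibniz (F := fun x s => pdx w x s ^ 2)
    (F' := fun x s => 2 * (pdx w x s * pdt (pdx w) x s)) 0 x t (hw.x.pow 2).cont
    (continuous_const.mul (hw.x.mul hw.x.t).cont) (fun y s => by
      have := (hw.x.ht y s).pow 2
      refine this.congr_deriv ?_
      push_cast; ring)).const_mul (-(1/2) : ℝ)
  unfold uF utF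
  refine h.congr_deriv ?_
  rw [intervalIntegral.integral_const_mul]
  ring

lemma utF_t {w : ℝ → ℝ → ℝ} (hw : Sm w) (x t : ℝ) :
    HasDerivAt (fun s => utF w x s) (uttF w x t) t := by
  have h := (leibniz (F := fun x s => pdx w x s * pdt (pdx w) x s)
    (F' := fun x s => (pdt (pdx w) x s) ^ 2 + pdx w x s * pdt (pdt (pdx w)) x s) 0 x t
    (hw.x.mul hw.x.t).cont
    ((hw.x.t.pow 2).cont.add (hw.x.mul hw.x.t.t).cont) (fun y s => by
      have := (hw.x.ht y s).mul (hw.x.t.ht y s)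
      refine this.congr_deriv ?_
      ring)).neg
  exact h

lemma uF_cont {w : ℝ → ℝ → ℝ} (hw : Sm w) : Continuous (fun q : ℝ × ℝ => uF w q.1 q.2) := by
  unfold uF
  exact continuous_const.mul (cont_prim (F := fun x s => pdx w x s ^ 2) 0 (hw.x.pow 2).cont)

lemma utF_cont {w : ℝ → ℝ → ℝ} (hw : Sm w) : Continuous (fun q : ℝ × ℝ => utF w q.1 q.2) := by
  unfold utF
  exact (cont_prim (F := fun x s => pdx w x s * pdt (pdx w) x s) 0 (hw.x.mul hw.x.t).cont).neg

lemma uttF_cont {w : ℝ → ℝ → ℝ} (hw : Sm w) : Continuous (fun q : ℝ × ℝ => uttF w q.1 q.2) := by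
  unfold uttF
  exact (cont_prim
    (F := fun x s => (pdt (pdx w) x s) ^ 2 + pdx w x s * pdt (pdt (pdx w)) x s) 0
    ((hw.x.t.pow 2).cont.add (hw.x.mul hw.x.t.t).cont)).neg

lemma cont_slice {f : ℝ → ℝ → ℝ} (hf : Continuous (fun q : ℝ × ℝ => f q.1 q.2)) (t : ℝ) :
    Continuous (fun x => f x t) :=
  hf.comp (by fun_prop : Continuous fun x : ℝ => (x, t))

lemma uF_x {w : ℝ → ℝ → ℝ} (hw : Sm w) (x t : ℝ) :
    HasDerivAt (fun y => uF w y t) (-(1/2) * (pdx w x t) ^ 2) x :=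
  (hasDerivAt_prim 0 x ((hw.x.pow 2).contx t)).const_mul (-(1/2) : ℝ)

lemma utF_x {w : ℝ → ℝ → ℝ} (hw : Sm w) (x t : ℝ) :
    HasDerivAt (fun y => utF w y t) (-(pdx w x t * pdt (pdx w) x t)) x :=
  (hasDerivAt_prim 0 x ((hw.x.mul hw.x.t).contx t)).neg

lemma ibp {φ φ1 φ2 S2 S3 S4 P J z w1 utt : ℝ → ℝ} {L D : ℝ}
    (h1 : ∀ x, HasDerivAt φ (φ1 x) x) (h2 : ∀ x, HasDerivAt φ1 (φ2 x) x)
    (h3 : ∀ x, HasDerivAt S3 (S4 x) x)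
    (h4 : ∀ x, HasDerivAt S2 (S3 x + D * P x - w1 x * J x) x)
    (h5 : ∀ x, HasDerivAt z (-(φ1 x * w1 x)) x) (h6 : ∀ x, HasDerivAt J (-utt x) x)
    (cφ2 : Continuous φ2) (cS4 : Continuous S4) (cP : Continuous P) (cu : Continuous utt)
    (b1 : φ 0 = 0) (b2 : φ1 0 = 0) (b3 : z 0 = 0)
    (b4 : S3 L = 0) (b5 : S2 L = 0) (b6 : J L = 0) :
    ∫ x in (0:ℝ)..L, (-(φ x * S4 x) + (φ2 x * S2 x + φ1 x * D * P x + z x * utt x)) = 0 := by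
  have cc : ∀ {f f' : ℝ → ℝ}, (∀ x, HasDerivAt f (f' x) x) → Continuous f := fun h =>
    continuous_iff_continuousAt.2 fun y => (h y).continuousAt
  have c1 := cc h1
  have c2 := cc h2
  have c3 := cc h4
  have c4 := cc h5
  have hB : ∀ x, HasDerivAt (fun x => φ1 x * S2 x - φ x * S3 x - z x * J x)
      (-(φ x * S4 x) + (φ2 x * S2 x + φ1 x * D * P x + z x * utt x)) x := by
    intro x
    have := (((h2 x).mul (h4 x)).sub ((h1 x).mul (h3 x))).sub ((h5 x).mul (h6 x))
    refine this.congr_deriv ?_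
    ring
  rw [intervalIntegral.integral_eq_sub_of_hasDerivAt (fun x _ => hB x)
    (Continuous.intervalIntegrable (by fun_prop) _ _)]
  simp [b1, b2, b3, b4, b5, b6]

/-- Globally smooth functions solving the problem on the rectangle. -/
structure GSol (L D k2 T : ℝ) (w : ℝ → ℝ → ℝ) : Prop where
  sm : Sm w
  pde : ∀ x ∈ Icc (0:ℝ) L, ∀ t ∈ Icc (0:ℝ) T,
      pdt (pdt w) x t + D * pdx (pdx (pdx (pdx w))) x t
        + k2 * pdx (pdx (pdx (pdx (pdt w)))) x t
        - D * pdx (fun y s => (pdx (pdx w) y s) ^ 2 * pdx w y s) x t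
        + D * pdx (pdx (fun y s => (pdx w y s) ^ 2 * pdx (pdx w) y s)) x t
        + pdx (fun y s => pdx w y s * ∫ ξ in y..L, uttF w ξ s) x t = 0
  bc : ∀ t ∈ Icc (0:ℝ) T,
    w 0 t = 0 ∧ pdx w 0 t = 0 ∧ pdx (pdx w) L t = 0 ∧ pdx (pdx (pdx w)) L t = 0

lemma GSol.bct {L D k2 T : ℝ} {w : ℝ → ℝ → ℝ} (h : GSol L D k2 T w) (hT : 0 < T) :
    ∀ t ∈ Icc (0:ℝ) T, pdt w 0 t = 0 ∧ pdx (pdt w) 0 t = 0 ∧ pdx (pdx (pdt w)) L t = 0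
      ∧ pdx (pdx (pdx (pdt w))) L t = 0 := by
  intro t ht
  have hw := h.sm
  refine ⟨?_, ?_, ?_, ?_⟩
  · exact deriv_zero_of_zero hT ht (fun s hs => (h.bc s hs).1) (hw.ht 0 t)
  · rw [← hw.comm]
    exact deriv_zero_of_zero hT ht (fun s hs => (h.bc s hs).2.1) (hw.x.ht 0 t)
  · rw [← hw.comm, ← hw.x.comm]
    exact deriv_zero_of_zero hT ht (fun s hs => (h.bc s hs).2.2.1) (hw.x.x.ht L t)
  · rw [← hw.comm, ← hw.x.comm, ← hw.x.x.comm]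
    exact deriv_zero_of_zero hT ht (fun s hs => (h.bc s hs).2.2.2) (hw.x.x.x.ht L t)

/-- The combined weak form, tested against `φ`. -/
lemma GSol.weak {L D k2 T : ℝ} {w : ℝ → ℝ → ℝ} (h : GSol L D k2 T w) (hL : 0 < L) (hT : 0 < T)
    {t : ℝ} (ht : t ∈ Icc 0 T) {φ φ1 φ2 z : ℝ → ℝ}
    (h1 : ∀ x, HasDerivAt φ (φ1 x) x) (h2 : ∀ x, HasDerivAt φ1 (φ2 x) x)
    (h5 : ∀ x, HasDerivAt z (-(φ1 x * pdx w x t)) x) (cφ2 : Continuous φ2)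
    (b1 : φ 0 = 0) (b2 : φ1 0 = 0) (b3 : z 0 = 0) :
    ∫ x in (0:ℝ)..L, (φ x * pdt (pdt w) x t
      + (φ2 x * (D * pdx (pdx w) x t + k2 * pdx (pdx (pdt w)) x t
            + D * (pdx w x t ^ 2 * pdx (pdx w) x t))
        + φ1 x * D * (pdx (pdx w) x t ^ 2 * pdx w x t) + z x * uttF w x t)) = 0 := by
  have hw := h.sm
  have hP : Sm (fun y s => (pdx (pdx w) y s) ^ 2 * pdx w y s) := (hw.x.x.pow 2).mul hw.x
  have hQ : Sm (fun y s => (pdx w y s) ^ 2 * pdx (pdx w) y s) := (hw.x.pow 2).mul hw.x.x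
  obtain ⟨bw1, bw2, bw3, bw4⟩ := h.bc t ht
  obtain ⟨bv1, bv2, bv3, bv4⟩ := h.bct hT t ht
  have cutt := cont_slice (uttF_cont hw) t
  have hJ : ∀ x, HasDerivAt (fun y => ∫ ξ in y..L, uttF w ξ t) (-uttF w x t) x :=
    fun x => hasDerivAt_prim' L x cutt
  have cJ : Continuous (fun y => ∫ ξ in y..L, uttF w ξ t) :=
    continuous_iff_continuousAt.2 fun y => (hJ y).continuousAt
  have hR : ∀ x, HasDerivAt (fun y => pdx w y t * ∫ ξ in y..L, uttF w ξ t)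
      (pdx (pdx w) x t * (∫ ξ in x..L, uttF w ξ t) + pdx w x t * (-uttF w x t)) x :=
    fun x => (hw.x.hx x t).mul (hJ x)
  have hR' : ∀ x, pdx (fun y s => pdx w y s * ∫ ξ in y..L, uttF w ξ s) x t =
      (pdx (pdx w) x t * (∫ ξ in x..L, uttF w ξ t) + pdx w x t * (-uttF w x t)) :=
    fun x => (hR x).deriv
  have hQ1 : ∀ x, pdx (fun y s => (pdx w y s) ^ 2 * pdx (pdx w) y s) x t =
      2 * pdx w x t * pdx (pdx w) x t * pdx (pdx w) x t
        + pdx w x t ^ 2 * pdx (pdx (pdx w)) x t := by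
    intro x
    have := ((hw.x.hx x t).pow 2).mul (hw.x.x.hx x t)
    refine (HasDerivAt.deriv this).trans ?_
    simp
  have cw1 := hw.x.contx t
  have cw2 := hw.x.x.contx t
  have cw4 := hw.x.x.x.x.contx t
  have cv4 := hw.t.x.x.x.x.contx t
  have cP1 := hP.x.contx t
  have cQ2 := hQ.x.x.contx t
  have key := ibp (φ := φ) (φ1 := φ1) (φ2 := φ2) (L := L) (D := D) (z := z)
    (w1 := fun x => pdx w x t) (utt := fun x => uttF w x t)
    (J := fun y => ∫ ξ in y..L, uttF w ξ t)
    (P := fun x => (pdx (pdx w) x t) ^ 2 * pdx w x t)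
    (S2 := fun x => D * pdx (pdx w) x t + k2 * pdx (pdx (pdt w)) x t
      + D * (pdx w x t ^ 2 * pdx (pdx w) x t))
    (S3 := fun x => D * pdx (pdx (pdx w)) x t + k2 * pdx (pdx (pdx (pdt w))) x t
      - D * ((pdx (pdx w) x t) ^ 2 * pdx w x t)
      + D * pdx (fun y s => (pdx w y s) ^ 2 * pdx (pdx w) y s) x t
      + pdx w x t * ∫ ξ in x..L, uttF w ξ t)
    (S4 := fun x => D * pdx (pdx (pdx (pdx w))) x t
        + k2 * pdx (pdx (pdx (pdx (pdt w)))) x t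
        - D * pdx (fun y s => (pdx (pdx w) y s) ^ 2 * pdx w y s) x t
        + D * pdx (pdx (fun y s => (pdx w y s) ^ 2 * pdx (pdx w) y s)) x t
        + (pdx (pdx w) x t * (∫ ξ in x..L, uttF w ξ t) + pdx w x t * (-uttF w x t)))
    h1 h2
    (fun x => ((((((hw.x.x.x.hx x t).const_mul D).add ((hw.t.x.x.x.hx x t).const_mul k2)).sub
      ((hP.hx x t).const_mul D)).add ((hQ.x.hx x t).const_mul D)).add (hR x)))
    (fun x => by
      have := (((hw.x.x.hx x t).const_mul D).add ((hw.t.x.x.hx x t).const_mul k2)).add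
        ((hQ.hx x t).const_mul D)
      refine this.congr_deriv ?_
      ring)
    h5 hJ cφ2 (by fun_prop) (by fun_prop) cutt b1 b2 b3
    (by simp [hQ1, bw3, bw4, bv4]) (by simp [bw3, bv3]) (by simp)
  refine Eq.trans ?_ key
  apply intervalIntegral.integral_congr
  intro x hx
  rw [uIcc_of_le hL.le] at hx
  have := h.pde x hx t ht
  rw [hR'] at this
  have e : pdt (pdt w) x t = -(D * pdx (pdx (pdx (pdx w))) x t
        + k2 * pdx (pdx (pdx (pdx (pdt w)))) x t
        - D * pdx (fun y s => (pdx (pdx w) y s) ^ 2 * pdx w y s) x t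
        + D * pdx (pdx (fun y s => (pdx w y s) ^ 2 * pdx (pdx w) y s)) x t
        + (pdx (pdx w) x t * (∫ ξ in x..L, uttF w ξ t) + pdx w x t * (-uttF w x t))) := by
    linarith
  simp only [e]
  ring

/-- Integrand of the energy. -/
noncomputable def eI (D : ℝ) (w : ℝ → ℝ → ℝ) (x t : ℝ) : ℝ :=
  pdt w x t ^ 2 + utF w x t ^ 2 + D * pdx (pdx w) x t ^ 2
    + D * (pdx w x t * pdx (pdx w) x t) ^ 2

/-- Integrand of the cross functional. -/
noncomputable def gI (k2 : ℝ) (w : ℝ → ℝ → ℝ) (x t : ℝ) : ℝ :=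
  w x t * pdt w x t + 2 * (uF w x t * utF w x t) + k2 / 2 * pdx (pdx w) x t ^ 2

lemma GSol.energy {L D k2 T : ℝ} {w : ℝ → ℝ → ℝ} (h : GSol L D k2 T w) (hL : 0 < L) (hT : 0 < T)
    {t : ℝ} (ht : t ∈ Icc 0 T) :
    HasDerivAt (fun s => ∫ x in (0:ℝ)..L, eI D w x s)
      (-(2 * k2) * ∫ x in (0:ℝ)..L, pdx (pdx (pdt w)) x t ^ 2) t := by
  have hw := h.sm
  have c1 := hw.x.cont
  have c2 := hw.x.x.cont
  have c3 := hw.t.cont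
  have c4 := hw.t.t.cont
  have c5 := hw.t.x.cont
  have c6 := hw.t.x.x.cont
  have c7 := utF_cont hw
  have c8 := uttF_cont hw
  have hl := leibniz (F := eI D w) (F' := fun x t =>
    2 * (pdt w x t * pdt (pdt w) x t + utF w x t * uttF w x t
      + D * (pdx (pdx w) x t * pdx (pdx (pdt w)) x t)
      + D * (pdx w x t * pdx (pdx w) x t * (pdx (pdt w) x t * pdx (pdx w) x t
        + pdx w x t * pdx (pdx (pdt w)) x t)))) 0 L t
    (by unfold eI; fun_prop) (by fun_prop) (by
      intro x t
      have e1 := hw.x.ht x t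
      have e2 := hw.x.x.ht x t
      rw [hw.x.comm, hw.comm] at e2
      rw [hw.comm] at e1
      have := ((((hw.t.ht x t).pow 2).add ((utF_t hw x t).pow 2)).add
        ((e2.pow 2).const_mul D)).add (((e1.mul e2).pow 2).const_mul D)
      refine this.congr_deriv ?_
      push_cast
      simp only [Pi.mul_apply]
      ring)
  refine hl.congr_deriv ?_
  obtain ⟨bv1, bv2, bv3, bv4⟩ := h.bct hT t ht
  have hk := h.weak hL hT ht (φ := fun x => pdt w x t) (φ1 := fun x => pdx (pdt w) x t)
    (φ2 := fun x => pdx (pdx (pdt w)) x t) (z := fun x => utF w x t)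
    (fun x => hw.t.hx x t) (fun x => hw.t.x.hx x t)
    (fun x => (utF_x hw x t).congr_deriv (by rw [hw.comm]; ring)) (hw.t.x.x.contx t)
    bv1 bv2 (by simp [utF])
  have d1 := cont_slice c1 t
  have d2 := cont_slice c2 t
  have d3 := cont_slice c3 t
  have d4 := cont_slice c4 t
  have d5 := cont_slice c5 t
  have d6 := cont_slice c6 t
  have d7 := cont_slice c7 t
  have d8 := cont_slice c8 t
  rw [← intervalIntegral.integral_const_mul, ← sub_eq_zero,
    ← intervalIntegral.integral_sub (Continuous.intervalIntegrable (by fun_prop) _ _)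
    (Continuous.intervalIntegrable (by fun_prop) _ _)]
  refine Eq.trans ?_ ((congrArg (fun r => 2 * r) hk).trans (mul_zero 2))
  rw [← intervalIntegral.integral_const_mul]
  congr 1
  funext x
  ring

lemma GSol.cross {L D k2 T : ℝ} {w : ℝ → ℝ → ℝ} (h : GSol L D k2 T w) (hL : 0 < L) (hT : 0 < T)
    {t : ℝ} (ht : t ∈ Icc 0 T) :
    HasDerivAt (fun s => ∫ x in (0:ℝ)..L, gI k2 w x s)
      (∫ x in (0:ℝ)..L, (pdt w x t ^ 2 + 2 * utF w x t ^ 2 - D * pdx (pdx w) x t ^ 2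
        - 2 * D * (pdx w x t * pdx (pdx w) x t) ^ 2)) t := by
  have hw := h.sm
  have c0 := hw.cont
  have c1 := hw.x.cont
  have c2 := hw.x.x.cont
  have c3 := hw.t.cont
  have c4 := hw.t.t.cont
  have c6 := hw.t.x.x.cont
  have c7 := utF_cont hw
  have c8 := uttF_cont hw
  have c9 := uF_cont hw
  have hl := leibniz (F := gI k2 w) (F' := fun x t =>
    pdt w x t * pdt w x t + w x t * pdt (pdt w) x t
      + 2 * (utF w x t * utF w x t + uF w x t * uttF w x t)
      + k2 * (pdx (pdx w) x t * pdx (pdx (pdt w)) x t)) 0 L t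
    (by unfold gI; fun_prop) (by fun_prop) (by
      intro x t
      have e2 := hw.x.x.ht x t
      rw [hw.x.comm, hw.comm] at e2
      have := (((hw.ht x t).mul (hw.t.ht x t)).add
        (((uF_t hw x t).mul (utF_t hw x t)).const_mul 2)).add
        ((e2.pow 2).const_mul (k2 / 2))
      refine this.congr_deriv ?_
      push_cast
      ring)
  refine hl.congr_deriv ?_
  obtain ⟨bv1, bv2, bv3, bv4⟩ := h.bc t ht
  have hk := h.weak hL hT ht (φ := fun x => w x t) (φ1 := fun x => pdx w x t)
    (φ2 := fun x => pdx (pdx w) x t) (z := fun x => 2 * uF w x t)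
    (fun x => hw.hx x t) (fun x => hw.x.hx x t)
    (fun x => ((uF_x hw x t).const_mul 2).congr_deriv (by ring)) (hw.x.x.contx t)
    bv1 bv2 (by simp [uF])
  have d0 := cont_slice c0 t
  have d1 := cont_slice c1 t
  have d2 := cont_slice c2 t
  have d3 := cont_slice c3 t
  have d4 := cont_slice c4 t
  have d6 := cont_slice c6 t
  have d7 := cont_slice c7 t
  have d8 := cont_slice c8 t
  have d9 := cont_slice c9 t
  rw [← sub_eq_zero,
    ← intervalIntegral.integral_sub (Continuous.intervalIntegrable (by fun_prop) _ _)
    (Continuous.intervalIntegrable (by fun_prop) _ _)]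
  refine Eq.trans ?_ hk
  congr 1
  funext x
  ring

lemma pdx_congr {I J : Set ℝ} (hI : IsOpen I) {f g : ℝ → ℝ → ℝ}
    (h : ∀ x ∈ I, ∀ t ∈ J, f x t = g x t) : ∀ x ∈ I, ∀ t ∈ J, pdx f x t = pdx g x t := by
  intro x hx t ht
  apply Filter.EventuallyEq.deriv_eq
  filter_upwards [hI.mem_nhds hx] with y hy using h y hy t ht

lemma pdt_congr {I J : Set ℝ} (hJ : IsOpen J) {f g : ℝ → ℝ → ℝ}
    (h : ∀ x ∈ I, ∀ t ∈ J, f x t = g x t) : ∀ x ∈ I, ∀ t ∈ J, pdt f x t = pdt g x t := by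
  intro x hx t ht
  apply Filter.EventuallyEq.deriv_eq
  filter_upwards [hJ.mem_nhds ht] with y hy using h x hx y hy

lemma exists_global {L D k2 T : ℝ} (hL : 0 < L) (hT : 0 < T) {w : ℝ → ℝ → ℝ}
    (h : IsFullSol L D k2 T (fun _ _ => 0) w) :
    ∃ W, GSol L D k2 T W ∧ ∀ t ∈ Icc 0 T, X0 L w t = X0 L W t := by
  obtain ⟨⟨U, hU, hKU, hsm⟩, hpde, hbc⟩ := h
  have hK : IsCompact (Icc (0:ℝ) L ×ˢ Icc (0:ℝ) T) := isCompact_Icc.prod isCompact_Icc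
  obtain ⟨χ, hχ0, hχ1, -⟩ := exists_contMDiffMap_zero_one_nhds_of_isClosed
    (n := (⊤ : ℕ∞))
    (modelWithCornersSelf ℝ (ℝ × ℝ)) hU.isClosed_compl hK.isClosed
    (disjoint_compl_left_iff_subset.2 hKU)
  have hχs : ContDiff ℝ (⊤ : ℕ∞) (χ : ℝ × ℝ → ℝ) := χ.contMDiff.contDiff
  let W : ℝ → ℝ → ℝ := fun x t => χ (x, t) * w x t
  have hW : Sm W := by
    refine contDiff_iff_contDiffAt.2 fun q => ?_
    by_cases hq : q ∈ U
    · exact hχs.contDiffAt.mul (hsm.contDiffAt (hU.mem_nhds hq))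
    · have h0 : (χ : ℝ × ℝ → ℝ) =ᶠ[nhds q] fun _ => 0 :=
        Filter.Eventually.filter_mono (nhds_le_nhdsSet (by exact hq)) hχ0
      have : (fun q : ℝ × ℝ => W q.1 q.2) =ᶠ[nhds q] fun _ => 0 := by
        filter_upwards [h0] with p hp
        simp [W, hp]
      exact contDiffAt_const.congr_of_eventuallyEq this
  obtain ⟨V, hVo, hKV, hV1⟩ := eventually_nhdsSet_iff_exists.1 hχ1
  obtain ⟨δ, hδ, hδV⟩ := hK.exists_thickening_subset_open hVo hKV
  have e0 : ∀ x ∈ Ioo (-δ) (L + δ), ∀ t ∈ Ioo (-δ) (T + δ), w x t = W x t := by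
    intro x hx t ht
    have : (x, t) ∈ Metric.thickening δ (Icc (0:ℝ) L ×ˢ Icc (0:ℝ) T) := by
      rw [Metric.mem_thickening_iff]
      refine ⟨(max 0 (min x L), max 0 (min t T)), ⟨⟨by simp, by simp [hL.le]⟩,
        ⟨by simp, by simp [hT.le]⟩⟩, ?_⟩
      rw [Prod.dist_eq, max_lt_iff]
      simp only [Real.dist_eq, abs_lt]
      obtain ⟨h1, h2⟩ := hx
      obtain ⟨h3, h4⟩ := ht
      refine ⟨⟨?_, ?_⟩, ⟨?_, ?_⟩⟩ <;>
      · rcases max_cases 0 (min x L) with h | h <;> rcases min_cases x L with h' | h' <;>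
        rcases max_cases 0 (min t T) with h'' | h'' <;> rcases min_cases t T with h3 | h3 <;>
        linarith
    simp [W, hV1 _ (hδV this)]
  have hI : IsOpen (Ioo (-δ) (L + δ)) := isOpen_Ioo
  have hJ : IsOpen (Ioo (-δ) (T + δ)) := isOpen_Ioo
  have ex := pdx_congr hI e0
  have et := pdt_congr hJ e0
  have exx := pdx_congr hI ex
  have exxx := pdx_congr hI exx
  have e4 := pdx_congr hI exxx
  have ext := pdt_congr hJ ex
  have extt := pdt_congr hJ ext
  have ett := pdt_congr hJ et
  have et4 := pdx_congr hI (pdx_congr hI (pdx_congr hI (pdx_congr hI et)))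
  have hseg : ∀ a ∈ Ioo (-δ) (L + δ), ∀ b ∈ Ioo (-δ) (L + δ), uIcc a b ⊆ Ioo (-δ) (L + δ) :=
    fun a ha b hb => (ordConnected_Ioo).uIcc_subset ha hb
  have hz : (0:ℝ) ∈ Ioo (-δ) (L + δ) := ⟨by linarith, by linarith⟩
  have hLI : L ∈ Ioo (-δ) (L + δ) := ⟨by linarith, by linarith⟩
  have eut : ∀ x ∈ Ioo (-δ) (L + δ), ∀ t ∈ Ioo (-δ) (T + δ), utF w x t = utF W x t := by
    intro x hx t ht
    unfold utF
    congr 1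
    apply intervalIntegral.integral_congr
    intro ξ hξ
    have hξ' := hseg _ hz _ hx hξ
    simp only [ex ξ hξ' t ht, ext ξ hξ' t ht]
  have eutt : ∀ x ∈ Ioo (-δ) (L + δ), ∀ t ∈ Ioo (-δ) (T + δ), uttF w x t = uttF W x t := by
    intro x hx t ht
    unfold uttF
    congr 1
    apply intervalIntegral.integral_congr
    intro ξ hξ
    have hξ' := hseg _ hz _ hx hξ
    simp only [ex ξ hξ' t ht, ext ξ hξ' t ht, extt ξ hξ' t ht]
  have eP := pdx_congr (J := Ioo (-δ) (T + δ)) hI (f := fun y s => (pdx (pdx w) y s) ^ 2 * pdx w y s)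
    (g := fun y s => (pdx (pdx W) y s) ^ 2 * pdx W y s)
    (fun x hx t ht => by simp only [ex x hx t ht, exx x hx t ht])
  have eQ := pdx_congr hI (pdx_congr (J := Ioo (-δ) (T + δ)) hI (f := fun y s => (pdx w y s) ^ 2 * pdx (pdx w) y s)
    (g := fun y s => (pdx W y s) ^ 2 * pdx (pdx W) y s)
    (fun x hx t ht => by simp only [ex x hx t ht, exx x hx t ht]))
  have eR := pdx_congr (J := Ioo (-δ) (T + δ)) hI (f := fun y s => pdx w y s * ∫ ξ in y..L, uttF w ξ s)
    (g := fun y s => pdx W y s * ∫ ξ in y..L, uttF W ξ s)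
    (fun x hx t ht => by
      have : ∫ ξ in x..L, uttF w ξ t = ∫ ξ in x..L, uttF W ξ t := by
        apply intervalIntegral.integral_congr
        intro ξ hξ
        exact eutt ξ (hseg _ hx _ hLI hξ) t ht
      simp only [ex x hx t ht, this])
  have hxI : ∀ x ∈ Icc 0 L, x ∈ Ioo (-δ) (L + δ) := fun x hx =>
    ⟨by linarith [hx.1], by linarith [hx.2]⟩
  have htJ : ∀ t ∈ Icc 0 T, t ∈ Ioo (-δ) (T + δ) := fun x hx =>
    ⟨by linarith [hx.1], by linarith [hx.2]⟩
  refine ⟨W, ⟨hW, ?_, ?_⟩, ?_⟩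
  · intro x hx t ht
    have := hpde x hx t ht
    have hx' := hxI x hx
    have ht' := htJ t ht
    rwa [ett x hx' t ht', e4 x hx' t ht', et4 x hx' t ht', eP x hx' t ht', eQ x hx' t ht',
      eR x hx' t ht'] at this
  · intro t ht
    have := hbc t ht
    have ht' := htJ t ht
    rwa [e0 0 hz t ht', ex 0 hz t ht', exx L hLI t ht', exxx L hLI t ht'] at this
  · intro t ht
    have ht' := htJ t ht
    unfold X0
    congr 1
    · congr 1
      · congr 1
        all_goals
          apply intervalIntegral.integral_congr
          intro x hx
          have hx' := hseg _ hz _ hLI hx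
          simp only [et x hx' t ht', exx x hx' t ht']
      · apply intervalIntegral.integral_congr
        intro x hx
        have hx' := hseg _ hz _ hLI hx
        simp only [ex x hx' t ht', exx x hx' t ht']
    · apply intervalIntegral.integral_congr
      intro x hx
      have hx' := hseg _ hz _ hLI hx
      simp only [eut x hx' t ht']

lemma GSol.vel {L D k2 T : ℝ} {w : ℝ → ℝ → ℝ} (h : GSol L D k2 T w) (hL : 0 < L) (hT : 0 < T)
    {t : ℝ} (ht : t ∈ Icc 0 T) :
    ∫ x in (0:ℝ)..L, pdt w x t ^ 2 ≤ L ^ 4 * ∫ x in (0:ℝ)..L, pdx (pdx (pdt w)) x t ^ 2 := by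
  have hw := h.sm
  obtain ⟨b1, b2, -, -⟩ := h.bct hT t ht
  have h1 := poincare hL.le (fun x => hw.t.hx x t) (hw.t.x.contx t) b1
  have h2 := poincare hL.le (fun x => hw.t.x.hx x t) (hw.t.x.x.contx t) b2
  calc _ ≤ _ := h1
    _ ≤ L ^ 2 * (L ^ 2 * ∫ x in (0:ℝ)..L, pdx (pdx (pdt w)) x t ^ 2) := by gcongr
    _ = _ := by ring

lemma GSol.ut_bound {L D k2 T : ℝ} {w : ℝ → ℝ → ℝ} (h : GSol L D k2 T w) (hL : 0 < L)
    {t : ℝ} (ht : t ∈ Icc 0 T) :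
    ∫ x in (0:ℝ)..L, utF w x t ^ 2 ≤ 4 * L * ((∫ x in (0:ℝ)..L, pdx (pdx w) x t ^ 2)
      * ∫ x in (0:ℝ)..L, pdt w x t ^ 2) := by
  have hw := h.sm
  obtain ⟨b1, b2, -, -⟩ := h.bc t ht
  set a := ∫ x in (0:ℝ)..L, pdx (pdx w) x t ^ 2 with ha
  set b := ∫ x in (0:ℝ)..L, pdt w x t ^ 2 with hb
  have ha0 : 0 ≤ a := intervalIntegral.integral_nonneg hL.le fun x _ => sq_nonneg _
  have d1 := hw.x.contx t
  have d2 := hw.x.x.contx t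
  have d3 := hw.t.contx t
  have d4 := hw.t.x.contx t
  have d5 := cont_slice (utF_cont hw) t
  have hp : ∀ x ∈ Icc 0 L, utF w x t ^ 2 ≤ 2 * L * a * pdt w x t ^ 2 + 2 * (a * b) := by
    intro x hx
    have e : ∫ y in (0:ℝ)..x, (pdx (pdx w) y t * pdt w y t + pdx w y t * pdx (pdt w) y t)
        = pdx w x t * pdt w x t := by
      rw [intervalIntegral.integral_eq_sub_of_hasDerivAt
        (fun y _ => (hw.x.hx y t).mul (hw.t.hx y t))
        (Continuous.intervalIntegrable (by fun_prop) _ _)]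
      simp [b2]
    rw [intervalIntegral.integral_add (Continuous.intervalIntegrable (by fun_prop) _ _)
      (Continuous.intervalIntegrable (by fun_prop) _ _)] at e
    have e2 : utF w x t = (∫ y in (0:ℝ)..x, pdx (pdx w) y t * pdt w y t)
        - pdx w x t * pdt w x t := by
      unfold utF
      rw [hw.comm]
      linarith
    have e3 := cauchy hx.1 d2 d3
    have e4 : ∫ y in (0:ℝ)..x, pdx (pdx w) y t ^ 2 ≤ a :=
      int_mono_top hx.1 hx.2 (d2.pow 2) (fun y => sq_nonneg _)
    have e5 : ∫ y in (0:ℝ)..x, pdt w y t ^ 2 ≤ b :=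
      int_mono_top hx.1 hx.2 (d3.pow 2) (fun y => sq_nonneg _)
    have e6 : 0 ≤ ∫ y in (0:ℝ)..x, pdt w y t ^ 2 :=
      intervalIntegral.integral_nonneg hx.1 fun x _ => sq_nonneg _
    have e7 : (∫ y in (0:ℝ)..x, pdx (pdx w) y t * pdt w y t) ^ 2 ≤ a * b :=
      e3.trans (mul_le_mul e4 e5 e6 ha0)
    have e8 : pdx w x t ^ 2 ≤ L * a := sup_bound (g := fun x => pdx w x t)
      (fun x => hw.x.hx x t) d2 b2 hx
    have e9 := mul_le_mul_of_nonneg_right e8 (sq_nonneg (pdt w x t))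
    rw [e2]
    nlinarith [sq_nonneg ((∫ y in (0:ℝ)..x, pdx (pdx w) y t * pdt w y t)
      + pdx w x t * pdt w x t)]
  have := intervalIntegral.integral_mono_on (μ := volume) hL.le
    ((d5.pow 2).intervalIntegrable 0 L)
    (Continuous.intervalIntegrable (by fun_prop) _ _) hp
  rw [intervalIntegral.integral_add (Continuous.intervalIntegrable (by fun_prop) _ _)
    (Continuous.intervalIntegrable (by fun_prop) _ _), intervalIntegral.integral_const_mul,
    intervalIntegral.integral_const] at this
  simp only [smul_eq_mul, sub_zero] at this
  calc _ ≤ _ := this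
    _ = _ := by rw [← hb]; ring

lemma GSol.cross_bound {L D k2 T : ℝ} {w : ℝ → ℝ → ℝ} (h : GSol L D k2 T w) (hL : 0 < L)
    (hk2 : 0 < k2) {t : ℝ} (ht : t ∈ Icc 0 T) :
    |∫ x in (0:ℝ)..L, gI k2 w x t| ≤ (L ^ 4 + 1 + k2) * X0 L w t := by
  have hw := h.sm
  obtain ⟨b1, b2, -, -⟩ := h.bc t ht
  have d0 := hw.contx t
  have d1 := hw.x.contx t
  have d2 := hw.x.x.contx t
  have d3 := hw.t.contx t
  have d5 := cont_slice (utF_cont hw) t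
  have d6 := cont_slice (uF_cont hw) t
  have hn : ∀ f : ℝ → ℝ, 0 ≤ ∫ x in (0:ℝ)..L, f x ^ 2 := fun f =>
    intervalIntegral.integral_nonneg hL.le fun x _ => sq_nonneg _
  have hi : ∀ {f : ℝ → ℝ}, Continuous f → IntervalIntegrable f volume 0 L := fun hf =>
    hf.intervalIntegrable _ _
  -- bound of `w`
  have p1 := poincare hL.le (fun x => hw.hx x t) d1 b1
  have p2 := poincare hL.le (fun x => hw.x.hx x t) d2 b2
  have p3 : ∫ x in (0:ℝ)..L, w x t ^ 2 ≤ L ^ 4 * ∫ x in (0:ℝ)..L, pdx (pdx w) x t ^ 2 :=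
    calc _ ≤ _ := p1
      _ ≤ L ^ 2 * (L ^ 2 * ∫ x in (0:ℝ)..L, pdx (pdx w) x t ^ 2) := by gcongr
      _ = _ := by ring
  -- bound of `u`
  have q1 := poincare hL.le (fun x => uF_x hw x t) (by fun_prop) (by simp [uF])
  have q2 := poincare (g := fun x => -(1/2) * (pdx w x t) ^ 2)
    (g' := fun x => -(pdx w x t * pdx (pdx w) x t)) hL.le
    (fun x => (((hw.x.hx x t).pow 2).const_mul (-(1/2) : ℝ)).congr_deriv (by
      push_cast; ring)) (by fun_prop) (by simp [b2])
  have q3 : ∫ x in (0:ℝ)..L, uF w x t ^ 2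
      ≤ L ^ 4 * ∫ x in (0:ℝ)..L, (pdx w x t * pdx (pdx w) x t) ^ 2 := by
    simp only [neg_sq] at q2
    calc _ ≤ _ := q1
      _ ≤ L ^ 2 * (L ^ 2 * ∫ x in (0:ℝ)..L, (pdx w x t * pdx (pdx w) x t) ^ 2) := by gcongr
      _ = _ := by ring
  have cg : Continuous (fun x => gI k2 w x t) := by unfold gI; fun_prop
  have m1 := intervalIntegral.abs_integral_le_integral_abs (μ := volume)
    (f := fun x => gI k2 w x t) hL.le
  have m2 : ∫ x in (0:ℝ)..L, |gI k2 w x t| ≤ ∫ x in (0:ℝ)..L,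
      ((w x t ^ 2 + pdt w x t ^ 2 + uF w x t ^ 2 + utF w x t ^ 2) + k2 * pdx (pdx w) x t ^ 2) := by
    apply intervalIntegral.integral_mono_on hL.le (hi cg.abs) (hi (by fun_prop))
    intro x _
    unfold gI
    have z := mul_nonneg hk2.le (sq_nonneg (pdx (pdx w) x t))
    rw [abs_le]
    constructor <;>
    nlinarith [sq_nonneg (w x t - pdt w x t), sq_nonneg (w x t + pdt w x t),
      sq_nonneg (uF w x t - utF w x t), sq_nonneg (uF w x t + utF w x t),
      sq_nonneg (w x t), sq_nonneg (pdt w x t)]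
  rw [intervalIntegral.integral_add (hi (by fun_prop)) (hi (by fun_prop)),
    intervalIntegral.integral_add (hi (by fun_prop)) (hi (by fun_prop)),
    intervalIntegral.integral_add (hi (by fun_prop)) (hi (by fun_prop)),
    intervalIntegral.integral_add (hi (by fun_prop)) (hi (by fun_prop)),
    intervalIntegral.integral_const_mul] at m2
  have n1 := hn (fun x => pdt w x t)
  have n2 := hn (fun x => pdx (pdx w) x t)
  have n3 := hn (fun x => pdx w x t * pdx (pdx w) x t)
  have n4 := hn (fun x => utF w x t)
  have hL4 : 0 < L ^ 4 := by positivity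
  refine (m1.trans m2).trans ?_
  unfold X0
  generalize (∫ x in (0:ℝ)..L, pdt w x t ^ 2) = b at *
  generalize (∫ x in (0:ℝ)..L, pdx (pdx w) x t ^ 2) = a at *
  generalize (∫ x in (0:ℝ)..L, (pdx w x t * pdx (pdx w) x t) ^ 2) = c at *
  generalize (∫ x in (0:ℝ)..L, utF w x t ^ 2) = e at *
  nlinarith [mul_nonneg hL4.le n1, mul_nonneg hL4.le n4, mul_nonneg hk2.le n1,
    mul_nonneg hk2.le n3, mul_nonneg hk2.le n4]

set_option maxHeartbeats 1000000 in
lemma final_bound {L D k2 T : ℝ} {w : ℝ → ℝ → ℝ} (hL : 0 < L) (hD : 0 < D) (hk2 : 0 < k2)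
    (hT : 0 < T) (h : GSol L D k2 T w) :
    X0 L w T + 1 * (∫ s in (0:ℝ)..T, X0 L w s) ≤
    ((1 + D) ^ 2 / D + (1 / D) * ((L ^ 4 + 1 + k2) * (1 + (1 + D) ^ 2 / D)
      + L ^ 4 * ((1 + D) / (2 * k2)) + 2 * (4 * L * (L ^ 4 * ((1 + D) / (2 * k2)))))
      + L ^ 4 * ((1 + D) / (2 * k2)) + 4 * L * (L ^ 4 * ((1 + D) / (2 * k2)))) * X0 L w 0
    + (4 * L + (1 / D) * (2 * (4 * L))) * ∫ s in (0:ℝ)..T, X0 L w s ^ 6 := by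
  have hw := h.sm
  have c1 := hw.x.cont
  have c2 := hw.x.x.cont
  have c3 := hw.t.cont
  have c6 := hw.t.x.x.cont
  have c7 := utF_cont hw
  have hn : ∀ f : ℝ → ℝ, 0 ≤ ∫ x in (0:ℝ)..L, f x ^ 2 := fun f =>
    intervalIntegral.integral_nonneg hL.le fun x _ => sq_nonneg _
  obtain ⟨a, ha⟩ : ∃ a : ℝ → ℝ, a = fun t => ∫ x in (0:ℝ)..L, pdx (pdx w) x t ^ 2 := ⟨_, rfl⟩
  obtain ⟨b, hb⟩ : ∃ b : ℝ → ℝ, b = fun t => ∫ x in (0:ℝ)..L, pdt w x t ^ 2 := ⟨_, rfl⟩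
  obtain ⟨c, hc⟩ : ∃ c : ℝ → ℝ, c = fun t =>
    ∫ x in (0:ℝ)..L, (pdx w x t * pdx (pdx w) x t) ^ 2 := ⟨_, rfl⟩
  obtain ⟨e, he⟩ : ∃ e : ℝ → ℝ, e = fun t => ∫ x in (0:ℝ)..L, utF w x t ^ 2 := ⟨_, rfl⟩
  obtain ⟨d, hd⟩ : ∃ d : ℝ → ℝ, d = fun t => ∫ x in (0:ℝ)..L, pdx (pdx (pdt w)) x t ^ 2 :=
    ⟨_, rfl⟩
  have a0 : ∀ t, 0 ≤ a t := fun t => by rw [ha]; exact hn _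
  have b0 : ∀ t, 0 ≤ b t := fun t => by rw [hb]; exact hn _
  have cc0 : ∀ t, 0 ≤ c t := fun t => by rw [hc]; exact hn _
  have e0 : ∀ t, 0 ≤ e t := fun t => by rw [he]; exact hn _
  have ca : Continuous a := by
    rw [ha]; exact cont_int (F := fun x t => pdx (pdx w) x t ^ 2) 0 L (by fun_prop)
  have cb : Continuous b := by
    rw [hb]; exact cont_int (F := fun x t => pdt w x t ^ 2) 0 L (by fun_prop)
  have cC : Continuous c := by
    rw [hc]; exact cont_int (F := fun x t => (pdx w x t * pdx (pdx w) x t) ^ 2) 0 L (by fun_prop)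
  have ce : Continuous e := by
    rw [he]; exact cont_int (F := fun x t => utF w x t ^ 2) 0 L (by fun_prop)
  have cd : Continuous d := by
    rw [hd]; exact cont_int (F := fun x t => pdx (pdx (pdt w)) x t ^ 2) 0 L (by fun_prop)
  have hX : X0 L w = fun t => b t + a t + c t + e t := by
    funext t; rw [ha, hb, hc, he]; rfl
  have hi : ∀ {f : ℝ → ℝ} {p q : ℝ}, Continuous f → IntervalIntegrable f volume p q := fun hf =>
    hf.intervalIntegrable _ _
  have hE : ∀ t, ∫ x in (0:ℝ)..L, eI D w x t = b t + e t + D * a t + D * c t := by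
    intro t
    have d1 := cont_slice c1 t
    have d2 := cont_slice c2 t
    have d3 := cont_slice c3 t
    have d7 := cont_slice c7 t
    unfold eI
    rw [intervalIntegral.integral_add (hi (by fun_prop)) (hi (by fun_prop)),
      intervalIntegral.integral_add (hi (by fun_prop)) (hi (by fun_prop)),
      intervalIntegral.integral_add (hi (by fun_prop)) (hi (by fun_prop)),
      intervalIntegral.integral_const_mul, intervalIntegral.integral_const_mul, ha, hb, hc, he]
  have hG : ∀ t, ∫ x in (0:ℝ)..L, (pdt w x t ^ 2 + 2 * utF w x t ^ 2 - D * pdx (pdx w) x t ^ 2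
      - 2 * D * (pdx w x t * pdx (pdx w) x t) ^ 2)
      = b t + 2 * e t - D * a t - 2 * D * c t := by
    intro t
    have d1 := cont_slice c1 t
    have d2 := cont_slice c2 t
    have d3 := cont_slice c3 t
    have d7 := cont_slice c7 t
    rw [intervalIntegral.integral_sub (hi (by fun_prop)) (hi (by fun_prop)),
      intervalIntegral.integral_sub (hi (by fun_prop)) (hi (by fun_prop)),
      intervalIntegral.integral_add (hi (by fun_prop)) (hi (by fun_prop)),
      intervalIntegral.integral_const_mul, intervalIntegral.integral_const_mul,
      intervalIntegral.integral_const_mul, ha, hb, hc, he]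
  -- energy identity
  have E1 : -(2 * k2) * ∫ t in (0:ℝ)..T, d t
      = (b T + e T + D * a T + D * c T) - (b 0 + e 0 + D * a 0 + D * c 0) := by
    rw [← hE, ← hE, ← intervalIntegral.integral_const_mul]
    apply intervalIntegral.integral_eq_sub_of_hasDerivAt
      (f := fun t => ∫ x in (0:ℝ)..L, eI D w x t)
    · intro t ht
      rw [uIcc_of_le hT.le] at ht
      rw [hd]
      exact h.energy hL hT ht
    · exact hi (by fun_prop)
  have G1 : ∫ t in (0:ℝ)..T, (b t + 2 * e t - D * a t - 2 * D * c t)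
      = (∫ x in (0:ℝ)..L, gI k2 w x T) - ∫ x in (0:ℝ)..L, gI k2 w x 0 := by
    apply intervalIntegral.integral_eq_sub_of_hasDerivAt
      (f := fun t => ∫ x in (0:ℝ)..L, gI k2 w x t)
    · intro t ht
      rw [uIcc_of_le hT.le] at ht
      rw [← hG]
      exact h.cross hL hT ht
    · exact hi (by fun_prop)
  have GT := (abs_le.1 (h.cross_bound hL hk2 (t := T) ⟨hT.le, le_rfl⟩)).1
  have G0 := (abs_le.1 (h.cross_bound hL hk2 (t := 0) ⟨le_rfl, hT.le⟩)).2
  rw [intervalIntegral.integral_sub (hi (by fun_prop)) (hi (by fun_prop)),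
      intervalIntegral.integral_sub (hi (by fun_prop)) (hi (by fun_prop)),
      intervalIntegral.integral_add (hi (by fun_prop)) (hi (by fun_prop)),
      intervalIntegral.integral_const_mul, intervalIntegral.integral_const_mul,
      intervalIntegral.integral_const_mul] at G1
  have B1 : ∫ t in (0:ℝ)..T, b t ≤ L ^ 4 * ∫ t in (0:ℝ)..T, d t := by
    rw [← intervalIntegral.integral_const_mul]
    apply intervalIntegral.integral_mono_on hT.le (hi cb) (hi (by fun_prop))
    intro t ht
    rw [hb, hd]
    exact h.vel hL hT ht
  have cX : Continuous (X0 L w) := by rw [hX]; fun_prop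
  have B2 : ∫ t in (0:ℝ)..T, e t ≤ 4 * L * ((∫ t in (0:ℝ)..T, b t)
      + ∫ t in (0:ℝ)..T, X0 L w t ^ 6) := by
    rw [← intervalIntegral.integral_add (hi cb) (hi (by fun_prop)),
      ← intervalIntegral.integral_const_mul]
    apply intervalIntegral.integral_mono_on hT.le (hi ce) (hi (by fun_prop))
    intro t ht
    have h1 : e t ≤ 4 * L * (a t * b t) := by
      rw [ha, hb, he]; exact h.ut_bound hL ht
    refine h1.trans ?_
    gcongr
    have ax : a t ≤ X0 L w t := by rw [hX]; linarith [b0 t, cc0 t, e0 t]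
    have bx : b t ≤ X0 L w t := by rw [hX]; linarith [a0 t, cc0 t, e0 t]
    have x0 := (a0 t).trans ax
    rcases le_total (X0 L w t) 1 with hx | hx
    · have : a t * b t ≤ 1 * b t := mul_le_mul_of_nonneg_right (ax.trans hx) (b0 t)
      have := pow_nonneg x0 6
      linarith
    · have h2 : a t * b t ≤ X0 L w t * X0 L w t := mul_le_mul ax bx (b0 t) x0
      have h3 : X0 L w t ^ 2 ≤ X0 L w t ^ 6 := pow_le_pow_right₀ hx (by norm_num)
      nlinarith [b0 t]
  have I1 : ∫ t in (0:ℝ)..T, X0 L w t = (∫ t in (0:ℝ)..T, b t) + (∫ t in (0:ℝ)..T, a t)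
      + (∫ t in (0:ℝ)..T, c t) + ∫ t in (0:ℝ)..T, e t := by
    rw [hX, intervalIntegral.integral_add (hi (by fun_prop)) (hi (by fun_prop)),
      intervalIntegral.integral_add (hi (by fun_prop)) (hi (by fun_prop)),
      intervalIntegral.integral_add (hi (by fun_prop)) (hi (by fun_prop))]
  have d0 : 0 ≤ ∫ t in (0:ℝ)..T, d t :=
    intervalIntegral.integral_nonneg hT.le fun t _ => by rw [hd]; exact hn _
  have ci0 : 0 ≤ ∫ t in (0:ℝ)..T, c t :=
    intervalIntegral.integral_nonneg hT.le fun t _ => cc0 t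
  have hXT : X0 L w T = b T + a T + c T + e T := by rw [hX]
  have hX0 : X0 L w 0 = b 0 + a 0 + c 0 + e 0 := by rw [hX]
  have aT := a0 T
  have bT := b0 T
  have cT := cc0 T
  have eT := e0 T
  have a00 := a0 0
  have b00 := b0 0
  have c00 := cc0 0
  have e00 := e0 0
  rw [I1]
  generalize (∫ t in (0:ℝ)..T, X0 L w t ^ 6) = Y at *
  generalize X0 L w T = XT at *
  generalize X0 L w 0 = XZ at *
  generalize (∫ t in (0:ℝ)..T, a t) = Ia at *
  generalize (∫ t in (0:ℝ)..T, b t) = Ib at *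
  generalize (∫ t in (0:ℝ)..T, c t) = Ic at *
  generalize (∫ t in (0:ℝ)..T, d t) = Id at *
  generalize (∫ t in (0:ℝ)..T, e t) = Ie at *
  have ME0 : b 0 + e 0 + D * a 0 + D * c 0 ≤ (1 + D) * XZ := by
    rw [hX0]
    nlinarith [mul_nonneg hD.le b00, mul_nonneg hD.le e00]
  have mET : D / (1 + D) * XT ≤ b T + e T + D * a T + D * c T := by
    rw [hXT, div_mul_eq_mul_div, div_le_iff₀ (by positivity)]
    nlinarith [mul_nonneg hD.le aT, mul_nonneg hD.le cT, mul_nonneg (mul_nonneg hD.le hD.le) aT,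
      mul_nonneg (mul_nonneg hD.le hD.le) cT]
  have XTb : XT ≤ (1 + D) ^ 2 / D * XZ := by
    have h1 : D / (1 + D) * XT ≤ (1 + D) * XZ := by nlinarith [mul_nonneg hk2.le d0]
    rw [div_mul_eq_mul_div, div_le_iff₀ (by positivity)] at h1
    rw [div_mul_eq_mul_div, le_div_iff₀ hD]
    nlinarith
  have XT0 : 0 ≤ XT := by rw [hXT]; positivity
  have Idb : Id ≤ (1 + D) / (2 * k2) * XZ := by
    rw [div_mul_eq_mul_div, le_div_iff₀ (by positivity)]
    nlinarith [mul_nonneg hD.le aT, mul_nonneg hD.le cT]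
  have Ibb : Ib ≤ L ^ 4 * ((1 + D) / (2 * k2)) * XZ := by
    calc Ib ≤ L ^ 4 * Id := B1
      _ ≤ L ^ 4 * ((1 + D) / (2 * k2) * XZ) := by gcongr
      _ = _ := by ring
  generalize L ^ 4 * ((1 + D) / (2 * k2)) = β at *
  generalize (1 + D) ^ 2 / D = r at *
  have Ieb : Ie ≤ 4 * L * (β * XZ + Y) := by
    refine B2.trans ?_
    gcongr
  have hκ : (0:ℝ) < L ^ 4 + 1 + k2 := by positivity
  generalize L ^ 4 + 1 + k2 = κ at *
  have K1 : D * (Ia + Ic) ≤ κ * XZ + κ * (r * XZ) + β * XZ + 2 * (4 * L * (β * XZ + Y)) := by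
    have := mul_le_mul_of_nonneg_left XTb hκ.le
    have h2 := mul_nonneg hD.le ci0
    have h3 : D * (Ia + Ic) = D * Ia + 2 * D * Ic - D * Ic := by ring
    linarith
  have K2 : Ia + Ic ≤ 1 / D * (κ * XZ + κ * (r * XZ) + β * XZ + 2 * (4 * L * (β * XZ + Y))) := by
    rw [one_div_mul_eq_div, le_div_iff₀ hD]
    linarith
  calc XT + 1 * (Ib + Ia + Ic + Ie) ≤ r * XZ + 1 / D * (κ * XZ + κ * (r * XZ) + β * XZ
        + 2 * (4 * L * (β * XZ + Y))) + β * XZ + 4 * L * (β * XZ + Y) := by linarith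
    _ = _ := by ring

/-- Level-zero stabilization inequality ((6.12) of the paper): for some constants
`C₁, C₂, C₃ > 0` depending only on `L, D, k₂`, every unforced classical solution
satisfies `X₀(T) + C₁∫₀ᵀ X₀ ≤ C₂ X₀(0) + C₃∫₀ᵀ X₀⁶`. -/
theorem level_zero_stabilization
    (L D k2 : ℝ) (hL : 0 < L) (hD : 0 < D) (hk2 : 0 < k2) :
    ∃ C1 C2 C3 : ℝ, 0 < C1 ∧ 0 < C2 ∧ 0 < C3 ∧
      ∀ T : ℝ, 0 < T → ∀ w : ℝ → ℝ → ℝ,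
        IsFullSol L D k2 T (fun _ _ => 0) w →
        X0 L w T + C1 * (∫ s in (0:ℝ)..T, X0 L w s)
          ≤ C2 * X0 L w 0 + C3 * ∫ s in (0:ℝ)..T, (X0 L w s) ^ 6 := by
  refine ⟨1, (1 + D) ^ 2 / D + (1 / D) * ((L ^ 4 + 1 + k2) * (1 + (1 + D) ^ 2 / D)
    + L ^ 4 * ((1 + D) / (2 * k2)) + 2 * (4 * L * (L ^ 4 * ((1 + D) / (2 * k2)))))
    + L ^ 4 * ((1 + D) / (2 * k2)) + 4 * L * (L ^ 4 * ((1 + D) / (2 * k2))),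
    4 * L + (1 / D) * (2 * (4 * L)), one_pos, by positivity, by positivity, ?_⟩
  intro T hT w hw
  obtain ⟨W, hW, hX⟩ := exists_global hL hT hw
  have e1 : ∫ s in (0:ℝ)..T, X0 L w s = ∫ s in (0:ℝ)..T, X0 L W s := by
    apply intervalIntegral.integral_congr
    intro s hs
    rw [uIcc_of_le hT.le] at hs
    exact hX s hs
  have e2 : ∫ s in (0:ℝ)..T, X0 L w s ^ 6 = ∫ s in (0:ℝ)..T, X0 L W s ^ 6 := by
    apply intervalIntegral.integral_congr
    intro s hs
    rw [uIcc_of_le hT.le] at hs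
    simp only [hX s hs]
  rw [e1, e2, hX T ⟨hT.le, le_rfl⟩, hX 0 ⟨le_rfl, hT.le⟩]
  exact final_bound hL hD hk2 hT hW
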